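/- For every fixed R : Matrix (Fin r) (Fin n) ℝ and every L, the function L ↦ f(L, R) is differentiable at L and its gradient with respect to the Frobenius inner product is the matrix G : Matrix (Fin m) (Fin r) ℝ given entrywise by G i k = ν · L i k + Σ_j ( max ((L * R) i j - u i j) 0 - max (l i j - (L * R) i j) 0 ) · R k j. -/

import Mathlib

/-- The inequality-constrained matrix-completion objective, on the space of matrices
equipped with the Frobenius (entrywise) inner product, modelled as
`EuclideanSpace ℝ (Fin m × Fin r)` and `EuclideanSpace ℝ (Fin r × Fin n)`;
`(L * R) i j = ∑ k, L (i,k) * R (k,j)` and `‖·‖` is the Frobenius norm. -/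
noncomputable def objf (m n r : ℕ) (ν : ℝ) (l u : Matrix (Fin m) (Fin n) ℝ)
    (L : EuclideanSpace ℝ (Fin m × Fin r)) (R : EuclideanSpace ℝ (Fin r × Fin n)) : ℝ :=
  (1 / 2) * ∑ i, ∑ j, (max (l i j - ∑ k, L (i, k) * R (k, j)) 0) ^ 2
    + (1 / 2) * ∑ i, ∑ j, (max ((∑ k, L (i, k) * R (k, j)) - u i j) 0) ^ 2
    + (ν / 2) * ‖L‖ ^ 2 + (ν / 2) * ‖R‖ ^ 2

theorem hasDerivAt_max_sq (t : ℝ) :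
    HasDerivAt (fun s : ℝ => (max s 0) ^ 2) (2 * max t 0) t := by
  rw [hasDerivAt_iff_isLittleO]
  have h1 : (fun s : ℝ => (max s 0) ^ 2 - (max t 0) ^ 2 - (s - t) • (2 * max t 0))
      =O[nhds t] fun s => (s - t) ^ 2 := by
    refine Asymptotics.IsBigO.of_bound 1 (Filter.Eventually.of_forall fun s => ?_)
    rw [Real.norm_eq_abs, Real.norm_eq_abs, abs_of_nonneg (sq_nonneg (s - t)), one_mul,
      smul_eq_mul, abs_le]
    rcases le_total s 0 with hs | hs <;> rcases le_total t 0 with ht | ht <;>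
      simp only [max_eq_left, max_eq_right, hs, ht] <;> constructor <;>
      nlinarith [sq_nonneg (s - t), sq_nonneg s, sq_nonneg t]
  refine h1.trans_isLittleO ?_
  have h2 : (fun s : ℝ => (s - t) ^ 2) =o[nhds t] fun s => s - t := by
    have := (Asymptotics.isLittleO_pow_id (𝕜 := ℝ) (n := 2) (by norm_num))
    have h3 : Filter.Tendsto (fun s : ℝ => s - t) (nhds t) (nhds 0) := by
      have : Continuous (fun s : ℝ => s - t) := by fun_prop
      simpa using this.tendsto t
    exact this.comp_tendsto h3
  exact h2

/-- For every fixed `R` and every `L`, the map `L' ↦ f(L', R)` is differentiable at `L`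
and its gradient with respect to the Frobenius inner product is the matrix `G` given
entrywise by
`G i k = ν·L i k + Σ_j (max ((L*R) i j - u i j) 0 - max (l i j - (L*R) i j) 0) · R k j`. -/
theorem explicit_gradient (m n r : ℕ) (hm : 0 < m) (hn : 0 < n) (hr : 0 < r)
    (ν : ℝ) (hν : 0 < ν) (l u : Matrix (Fin m) (Fin n) ℝ)
    (hlu : ∀ i j, l i j ≤ u i j)
    (L G : EuclideanSpace ℝ (Fin m × Fin r)) (R : EuclideanSpace ℝ (Fin r × Fin n))
    (hG : ∀ (i : Fin m) (k : Fin r),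
      G (i, k) = ν * L (i, k)
        + ∑ j, (max ((∑ k', L (i, k') * R (k', j)) - u i j) 0
                 - max (l i j - ∑ k', L (i, k') * R (k', j)) 0) * R (k, j)) :
    HasGradientAt (fun L' => objf m n r ν l u L' R) G L := by
  have hlin : ∀ (i : Fin m) (j : Fin n),
      HasFDerivAt (fun L' : EuclideanSpace ℝ (Fin m × Fin r) => ∑ k, L' (i, k) * R (k, j))
        (∑ k, R (k, j) • (EuclideanSpace.proj (i, k) : EuclideanSpace ℝ (Fin m × Fin r) →L[ℝ] ℝ))
        L := by
    intro i j
    refine HasFDerivAt.fun_sum fun k _ => ?_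
    exact ((EuclideanSpace.proj (i, k) :
      EuclideanSpace ℝ (Fin m × Fin r) →L[ℝ] ℝ).hasFDerivAt).mul_const (R (k, j))
  have h1 := fun i j => (hasDerivAt_max_sq _).comp_hasFDerivAt L ((hlin i j).const_sub (l i j))
  have h2 := fun i j => (hasDerivAt_max_sq _).comp_hasFDerivAt L ((hlin i j).sub_const (u i j))
  have s1 := (HasFDerivAt.fun_sum (u := Finset.univ) fun i _ =>
    HasFDerivAt.fun_sum (u := Finset.univ) fun j _ => h1 i j).const_mul (1 / 2 : ℝ)
  have s2 := (HasFDerivAt.fun_sum (u := Finset.univ) fun i _ =>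
    HasFDerivAt.fun_sum (u := Finset.univ) fun j _ => h2 i j).const_mul (1 / 2 : ℝ)
  have s3 := (hasStrictFDerivAt_norm_sq L).hasFDerivAt.const_mul (ν / 2)
  have s := ((s1.add s2).add s3).add_const ((ν / 2) * ‖R‖ ^ 2)
  rw [hasGradientAt_iff_hasFDerivAt]
  refine HasFDerivAt.congr_fderiv s ?_
  ext v
  have hproj : ∀ p : Fin m × Fin r,
      (EuclideanSpace.proj p : EuclideanSpace ℝ (Fin m × Fin r) →L[ℝ] ℝ) v = v p := fun _ => rfl
  simp only [_root_.add_apply, _root_.smul_apply,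
    _root_.sum_apply, _root_.neg_apply, hproj,
    innerSL_apply_apply, InnerProductSpace.toDual_apply_apply, smul_eq_mul, PiLp.inner_apply,
    RCLike.inner_apply, conj_trivial, Fintype.sum_prod_type, hG, nsmul_eq_mul]
  have hk : ∀ i k, v (i, k) * (ν * L (i, k) + ∑ j, (max ((∑ k', L (i, k') * R (k', j)) - u i j) 0
                 - max (l i j - ∑ k', L (i, k') * R (k', j)) 0) * R (k, j)) =
      ν * (L (i, k) * v (i, k)) + ∑ j, (max ((∑ k', L (i, k') * R (k', j)) - u i j) 0
                 - max (l i j - ∑ k', L (i, k') * R (k', j)) 0) * (R (k, j) * v (i, k)) := by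
    intro i k
    rw [mul_add, Finset.mul_sum]
    congr 1
    · ring
    · exact Finset.sum_congr rfl fun j _ => by ring
  simp only [hk]
  rw [Finset.mul_sum, Finset.mul_sum, Finset.mul_sum, Finset.mul_sum,
    ← Finset.sum_add_distrib, ← Finset.sum_add_distrib]
  refine Finset.sum_congr rfl fun i _ => ?_
  rw [Finset.sum_add_distrib, Finset.sum_comm, add_comm]
  congr 1
  · rw [Finset.mul_sum, Finset.mul_sum]
    refine Finset.sum_congr rfl fun k _ => ?_
    push_cast
    ring
  · rw [Finset.mul_sum, Finset.mul_sum, ← Finset.sum_add_distrib]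
    refine Finset.sum_congr rfl fun j _ => ?_
    rw [← Finset.mul_sum]
    ring
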